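/- arXiv:2502.01076 — 5 statements merged into one kernel-verified Lean document; each statement's English description precedes it below -/
import Mathlib

section
/- Fix x ∈ ℝ^m and points y_T, y* ∈ ℝⁿ, u ∈ ℝⁿ. Suppose F and f are twice continuously differentiable with: ∇_xF(x,·) L_Fx-Lipschitz; ‖∇_yF(x,y*)‖ ≤ C_Fy; ∇²_{yy}f(x,y*) ⪰ μI with μ > 0; ∇²_{xy}f(x,·) L_fxy-Lipschitz with ‖∇²_{xy}f(x,y_T)‖ ≤ M_fxy. Define u* := [∇²_{yy}f(x,y*)]⁻¹∇_yF(x,y*), the hypergradient approximation ∇̃Φ := ∇_xF(x,y_T) − [∇²_{xy}f(x,y_T)]ᵀu, and G := ∇_xF(x,y*) − [∇²_{xy}f(x,y*)]ᵀu*. Then ‖∇̃Φ − G‖² ≤ 3(L_Fx² + L_fxy²C_Fy²/μ²)‖y_T − y*‖² + 3M_fxy²‖u − u*‖². -/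
noncomputable section

/-- The linear map on Euclidean space induced by a matrix. -/
def mvec {p q : ℕ} (A : Matrix (Fin p) (Fin q) ℝ) (v : EuclideanSpace ℝ (Fin q)) :
    EuclideanSpace ℝ (Fin p) :=
  Matrix.toEuclideanLin A v

/-- The `ℓ²`-operator norm of a matrix. -/
def opn {p q : ℕ} (A : Matrix (Fin p) (Fin q) ℝ) : ℝ :=
  ‖(Matrix.toEuclideanLin A).toContinuousLinearMap‖

/-- The transpose of a matrix acts with the operator norm of the matrix itself. -/
theorem norm_mvec_transpose_le {p q : ℕ} (A : Matrix (Fin p) (Fin q) ℝ)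
    (v : EuclideanSpace ℝ (Fin p)) : ‖mvec A.transpose v‖ ≤ opn A * ‖v‖ := by
  have hadj : mvec A.transpose v =
      ContinuousLinearMap.adjoint (Matrix.toEuclideanLin A).toContinuousLinearMap v := by
    rw [mvec, ← Matrix.conjTranspose_eq_transpose_of_trivial,
      Matrix.toEuclideanLin_conjTranspose_eq_adjoint]
    rfl
  rw [hadj, opn, ← LinearIsometryEquiv.norm_map ContinuousLinearMap.adjoint
    (Matrix.toEuclideanLin A).toContinuousLinearMap]
  exact ContinuousLinearMap.le_opNorm _ v

/-- If `A ⪰ μ I` with `μ > 0`, then `‖A⁻¹ v‖ ≤ ‖v‖ / μ`. -/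
theorem norm_mvec_inv_le {n : ℕ} {A : Matrix (Fin n) (Fin n) ℝ} {μ : ℝ} (hμ : 0 < μ)
    (hA : (A - μ • (1 : Matrix (Fin n) (Fin n) ℝ)).PosSemidef)
    (v : EuclideanSpace ℝ (Fin n)) : ‖mvec A⁻¹ v‖ ≤ ‖v‖ / μ := by
  have hpd : A.PosDef := by
    simpa using (Matrix.PosDef.one.smul hμ).posSemidef_add hA
  have hdet : IsUnit A.det := (Matrix.isUnit_iff_isUnit_det A).mp hpd.isUnit
  set w := mvec A⁻¹ v with hw
  have hv : mvec A w = v := by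
    simp [hw, mvec, Matrix.toLpLin_apply, Matrix.mulVec_mulVec,
      Matrix.mul_nonsing_inv A hdet]
  have hpos : 0 ≤ inner ℝ (mvec (A - μ • (1 : Matrix (Fin n) (Fin n) ℝ)) w) w :=
    (Matrix.isPositive_toEuclideanLin_iff.mpr hA).2 w
  have hsub : mvec (A - μ • (1 : Matrix (Fin n) (Fin n) ℝ)) w = v - μ • w := by
    rw [← hv]
    ext i
    simp [mvec, Matrix.toLpLin_apply]
  rw [hsub, inner_sub_left, real_inner_smul_left, real_inner_self_eq_norm_sq] at hpos
  have hcs := real_inner_le_norm v w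
  rw [le_div_iff₀ hμ]
  rcases (norm_nonneg w).eq_or_lt with h | h
  · simp [← h]
  · nlinarith

/-- Hypergradient approximation error bound:
`‖∇̃Φ − G‖² ≤ 3 (L_Fx² + L_fxy² C_Fy²/μ²) ‖y_T − y*‖² + 3 M_fxy² ‖u − u*‖²`. -/
theorem hypergradient_error_decomposition {m n : ℕ}
    (F f : EuclideanSpace ℝ (Fin m) → EuclideanSpace ℝ (Fin n) → ℝ)
    (hF : ContDiff ℝ 2 (fun p : EuclideanSpace ℝ (Fin m) × EuclideanSpace ℝ (Fin n) =>
      F p.1 p.2))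
    (hf : ContDiff ℝ 2 (fun p : EuclideanSpace ℝ (Fin m) × EuclideanSpace ℝ (Fin n) =>
      f p.1 p.2))
    -- the partial gradients of F and the partial gradient / second derivatives of f
    (Fx : EuclideanSpace ℝ (Fin m) → EuclideanSpace ℝ (Fin n) → EuclideanSpace ℝ (Fin m))
    (Fy fy : EuclideanSpace ℝ (Fin m) → EuclideanSpace ℝ (Fin n) → EuclideanSpace ℝ (Fin n))
    (fyy : EuclideanSpace ℝ (Fin m) → EuclideanSpace ℝ (Fin n) → Matrix (Fin n) (Fin n) ℝ)
    (fxy : EuclideanSpace ℝ (Fin m) → EuclideanSpace ℝ (Fin n) → Matrix (Fin n) (Fin m) ℝ)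
    (hFx : ∀ x y, HasGradientAt (fun x' => F x' y) (Fx x y) x)
    (hFy : ∀ x y, HasGradientAt (fun y' => F x y') (Fy x y) y)
    (hfy : ∀ x y, HasGradientAt (fun y' => f x y') (fy x y) y)
    (hfyy : ∀ x y, HasFDerivAt (fun y' => fy x y')
      (Matrix.toEuclideanLin (fyy x y)).toContinuousLinearMap y)
    (hfxy : ∀ x y, HasFDerivAt (fun x' => fy x' y)
      (Matrix.toEuclideanLin (fxy x y)).toContinuousLinearMap x)
    -- the fixed point and data
    (x : EuclideanSpace ℝ (Fin m)) (yT ystar u : EuclideanSpace ℝ (Fin n))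
    (LFx CFy μ Lfxy Mfxy : ℝ) (hμ : 0 < μ)
    (hFxLip : ∀ y₁ y₂, ‖Fx x y₁ - Fx x y₂‖ ≤ LFx * ‖y₁ - y₂‖)
    (hFybd : ‖Fy x ystar‖ ≤ CFy)
    (hsc : (fyy x ystar - μ • (1 : Matrix (Fin n) (Fin n) ℝ)).PosSemidef)
    (hfxyLip : ∀ y₁ y₂, opn (fxy x y₁ - fxy x y₂) ≤ Lfxy * ‖y₁ - y₂‖)
    (hfxybd : opn (fxy x yT) ≤ Mfxy) :
    ‖(Fx x yT - mvec (fxy x yT).transpose u) -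
        (Fx x ystar -
          mvec (fxy x ystar).transpose (mvec (fyy x ystar)⁻¹ (Fy x ystar)))‖ ^ 2 ≤
      3 * (LFx ^ 2 + Lfxy ^ 2 * CFy ^ 2 / μ ^ 2) * ‖yT - ystar‖ ^ 2 +
        3 * Mfxy ^ 2 * ‖u - mvec (fyy x ystar)⁻¹ (Fy x ystar)‖ ^ 2 := by
  set ustar := mvec (fyy x ystar)⁻¹ (Fy x ystar) with hustar
  have hustar_le : ‖ustar‖ ≤ CFy / μ :=
    (norm_mvec_inv_le hμ hsc _).trans (by gcongr)
  have hsplit : (Fx x yT - mvec (fxy x yT).transpose u) -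
      (Fx x ystar - mvec (fxy x ystar).transpose ustar) =
      (Fx x yT - Fx x ystar) - mvec (fxy x yT - fxy x ystar).transpose ustar -
        mvec (fxy x yT).transpose (u - ustar) := by
    simp only [mvec, Matrix.transpose_sub, map_sub, LinearMap.sub_apply]
    abel
  have hgrad := hFxLip yT ystar
  have hmixed : ‖mvec (fxy x yT - fxy x ystar).transpose ustar‖ ≤
      Lfxy * ‖yT - ystar‖ * (CFy / μ) :=
    (norm_mvec_transpose_le _ _).trans (mul_le_mul (hfxyLip _ _) hustar_le (norm_nonneg _)
      ((norm_nonneg _).trans (hfxyLip _ _)))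
  have hsolve : ‖mvec (fxy x yT).transpose (u - ustar)‖ ≤ Mfxy * ‖u - ustar‖ :=
    (norm_mvec_transpose_le _ _).trans (by gcongr)
  rw [hsplit]
  calc _ ≤ (LFx * ‖yT - ystar‖ + Lfxy * ‖yT - ystar‖ * (CFy / μ) + Mfxy * ‖u - ustar‖) ^ 2 := by
        gcongr
        exact (norm_sub_le _ _).trans
          (add_le_add ((norm_sub_le _ _).trans (add_le_add hgrad hmixed)) hsolve)
    _ ≤ 3 * ((LFx * ‖yT - ystar‖) ^ 2 + (Lfxy * ‖yT - ystar‖ * (CFy / μ)) ^ 2 +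
          (Mfxy * ‖u - ustar‖) ^ 2) := by
        linarith [sq_nonneg (LFx * ‖yT - ystar‖ - Lfxy * ‖yT - ystar‖ * (CFy / μ)),
          sq_nonneg (LFx * ‖yT - ystar‖ - Mfxy * ‖u - ustar‖),
          sq_nonneg (Lfxy * ‖yT - ystar‖ * (CFy / μ) - Mfxy * ‖u - ustar‖)]
    _ = _ := by ring
end
end

section
/- Let A be an n×n real symmetric matrix with μI ⪯ A ⪯ LI (0 < μ ≤ L). Let B₀ = LI and, for i = 0,…,k−1, let s_i ∈ ℝⁿ \ {0}, g_i = A s_i, and let B_{i+1} be the BFGS update of B_i with the pair (s_i, g_i). Assume A ⪯ B_i for every i (which holds throughout these updates). Then Σ_{i=0}^{k−1} ⟨(B_i − A)A⁻¹(B_i − A)s_i, s_i⟩ / ⟨B_i s_i, s_i⟩ ≤ nL/μ. -/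
open scoped Matrix

noncomputable section

/-- The (direct) BFGS update of a symmetric positive definite matrix `B` with a pair `(s, g)`,
`B⁺ = B − (B s sᵀ B)/(sᵀ B s) + (g gᵀ)/(gᵀ s)`. -/
def bfgsUpdate {n : ℕ} (B : Matrix (Fin n) (Fin n) ℝ) (s g : Fin n → ℝ) :
    Matrix (Fin n) (Fin n) ℝ :=
  B - (s ⬝ᵥ B.mulVec s)⁻¹ • Matrix.vecMulVec (B.mulVec s) (Matrix.vecMul s B)
    + (g ⬝ᵥ s)⁻¹ • Matrix.vecMulVec g g

open Matrix in
theorem Matrix.PosSemidef.trace_mul_nonneg {n : ℕ} {P Q : Matrix (Fin n) (Fin n) ℝ}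
    (hP : P.PosSemidef) (hQ : Q.PosSemidef) : 0 ≤ (P * Q).trace := by
  obtain ⟨m, v, rfl⟩ := posSemidef_iff_eq_sum_vecMulVec.mp hQ
  rw [Finset.mul_sum, trace_sum]
  refine Finset.sum_nonneg fun i _ => ?_
  rw [mul_vecMulVec, trace_vecMulVec, dotProduct_comm]
  exact hP.dotProduct_mulVec_nonneg (v i)

/-- The trace of the inverse of a matrix bounded below by `μ` is at most `n / μ`. -/
theorem trace_inv_le {n : ℕ} {A : Matrix (Fin n) (Fin n) ℝ} {μ : ℝ} (hμ : 0 < μ)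
    (hA : A.PosDef) (hAlow : (A - μ • (1 : Matrix (Fin n) (Fin n) ℝ)).PosSemidef) :
    A⁻¹.trace ≤ n / μ := by
  have hdet : IsUnit A.det := (Matrix.isUnit_iff_isUnit_det A).mp hA.isUnit
  have h := hA.inv.posSemidef.trace_mul_nonneg hAlow
  rw [Matrix.mul_sub, Matrix.nonsing_inv_mul A hdet, Matrix.mul_smul, Matrix.mul_one,
    Matrix.trace_sub, Matrix.trace_smul, Matrix.trace_one, Fintype.card_fin, smul_eq_mul] at h
  rw [le_div_iff₀ hμ]
  linarith

/-- One BFGS step along `(s, A s)` decreases `B ↦ tr (A⁻¹ (B - A))` by at least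
`⟨(B - A) A⁻¹ (B - A) s, s⟩ / ⟨B s, s⟩`. -/
theorem le_trace_sub_trace_bfgsUpdate {n : ℕ} {A B : Matrix (Fin n) (Fin n) ℝ}
    (hA : A.PosDef) (hAB : (B - A).PosSemidef) {s : Fin n → ℝ} (hs : s ≠ 0) :
    (((B - A) * A⁻¹ * (B - A)).mulVec s ⬝ᵥ s) / (B.mulVec s ⬝ᵥ s)
      ≤ (A⁻¹ * (B - A)).trace - (A⁻¹ * (bfgsUpdate B s (A.mulVec s) - A)).trace := by
  have hdet : IsUnit A.det := (Matrix.isUnit_iff_isUnit_det A).mp hA.isUnit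
  have hBsymm : Bᵀ = B := by
    have h := (hAB.isHermitian.add hA.isHermitian).eq
    rwa [sub_add_cancel, Matrix.conjTranspose_eq_transpose_of_trivial] at h
  have hsA : 0 < s ⬝ᵥ A.mulVec s := by simpa using hA.dotProduct_mulVec_pos hs
  have hsAB : s ⬝ᵥ A.mulVec s ≤ s ⬝ᵥ B.mulVec s := by
    have h := hAB.dotProduct_mulVec_nonneg s
    rw [star_trivial, Matrix.sub_mulVec, dotProduct_sub] at h
    linarith
  have hsB : 0 < s ⬝ᵥ B.mulVec s := hsA.trans_le hsAB
  have hvec : Matrix.vecMul s B = B.mulVec s := by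
    rw [← Matrix.mulVec_transpose, hBsymm]
  have hinv : A⁻¹.mulVec (A.mulVec s) = s := by
    rw [Matrix.mulVec_mulVec, Matrix.nonsing_inv_mul A hdet, Matrix.one_mulVec]
  have hnum : ((B - A) * A⁻¹ * (B - A)).mulVec s ⬝ᵥ s =
      A⁻¹.mulVec (B.mulVec s) ⬝ᵥ B.mulVec s - 2 * (s ⬝ᵥ B.mulVec s) + s ⬝ᵥ A.mulVec s := by
    have hexp : (B - A) * A⁻¹ * (B - A) = B * (A⁻¹ * B) - B - B + A := by
      simp only [Matrix.sub_mul, Matrix.mul_sub, Matrix.mul_nonsing_inv A hdet, Matrix.one_mul,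
        Matrix.mul_assoc, Matrix.nonsing_inv_mul A hdet, Matrix.mul_one]
      abel
    rw [hexp, dotProduct_comm]
    simp only [Matrix.sub_mulVec, Matrix.add_mulVec, dotProduct_sub, dotProduct_add,
      ← Matrix.mulVec_mulVec]
    rw [Matrix.dotProduct_mulVec s B (A⁻¹.mulVec _), hvec, dotProduct_comm (B.mulVec s)]
    ring
  have htr : (A⁻¹ * (B - A)).trace - (A⁻¹ * (bfgsUpdate B s (A.mulVec s) - A)).trace =
      (s ⬝ᵥ B.mulVec s)⁻¹ * (A⁻¹.mulVec (B.mulVec s) ⬝ᵥ B.mulVec s) - 1 := by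
    have hdiff : (B - A) - (bfgsUpdate B s (A.mulVec s) - A) =
        (s ⬝ᵥ B.mulVec s)⁻¹ • Matrix.vecMulVec (B.mulVec s) (B.mulVec s)
          - (s ⬝ᵥ A.mulVec s)⁻¹ • Matrix.vecMulVec (A.mulVec s) (A.mulVec s) := by
      rw [bfgsUpdate, hvec, dotProduct_comm (A.mulVec s)]
      abel
    rw [← Matrix.trace_sub, ← Matrix.mul_sub, hdiff]
    simp only [Matrix.mul_sub, Matrix.mul_smul, Matrix.mul_vecMulVec, Matrix.trace_sub,
      Matrix.trace_smul, Matrix.trace_vecMulVec, smul_eq_mul, hinv]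
    rw [inv_mul_cancel₀ hsA.ne']
  rw [hnum, htr, dotProduct_comm (B.mulVec s) s, div_le_iff₀ hsB, sub_mul,
    mul_right_comm, inv_mul_cancel₀ hsB.ne']
  linarith

/-- Let `A` be an `n × n` real symmetric matrix with `μI ⪯ A ⪯ LI`
(`0 < μ ≤ L`). Let `B₀ = LI` and, for `i = 0, …, k−1`, let `sᵢ ≠ 0`, `gᵢ = A sᵢ`, and let
`B_{i+1}` be the BFGS update of `Bᵢ` with the pair `(sᵢ, gᵢ)`.  Assuming `A ⪯ Bᵢ` throughout,
`Σ_{i<k} ⟨(Bᵢ − A) A⁻¹ (Bᵢ − A) sᵢ, sᵢ⟩ / ⟨Bᵢ sᵢ, sᵢ⟩ ≤ n L / μ`. -/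
theorem bfgs_trace_potential_sum {n k : ℕ} (A : Matrix (Fin n) (Fin n) ℝ)
    (μ L : ℝ) (hμ : 0 < μ) (hμL : μ ≤ L)
    (hAlow : (A - μ • (1 : Matrix (Fin n) (Fin n) ℝ)).PosSemidef)
    (hAupp : (L • (1 : Matrix (Fin n) (Fin n) ℝ) - A).PosSemidef)
    (B : ℕ → Matrix (Fin n) (Fin n) ℝ) (s : ℕ → Fin n → ℝ)
    (hB0 : B 0 = L • (1 : Matrix (Fin n) (Fin n) ℝ))
    (hs : ∀ i < k, s i ≠ 0)
    (hBstep : ∀ i < k, B (i + 1) = bfgsUpdate (B i) (s i) (A.mulVec (s i)))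
    (hAB : ∀ i ≤ k, (B i - A).PosSemidef) :
    ∑ i ∈ Finset.range k,
        (((B i - A) * A⁻¹ * (B i - A)).mulVec (s i) ⬝ᵥ s i) / ((B i).mulVec (s i) ⬝ᵥ s i)
      ≤ n * L / μ := by
  have hA : A.PosDef := by
    have h := (Matrix.PosDef.one (n := Fin n) (R := ℝ)).smul hμ
    simpa using h.add_posSemidef hAlow
  have hdet : IsUnit A.det := (Matrix.isUnit_iff_isUnit_det A).mp hA.isUnit
  calc _ ≤ ∑ i ∈ Finset.range k, ((A⁻¹ * (B i - A)).trace - (A⁻¹ * (B (i + 1) - A)).trace) := by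
        refine Finset.sum_le_sum fun i hi => ?_
        have hi' := Finset.mem_range.mp hi
        rw [hBstep i hi']
        exact le_trace_sub_trace_bfgsUpdate hA (hAB i hi'.le) (hs i hi')
    _ = (A⁻¹ * (B 0 - A)).trace - (A⁻¹ * (B k - A)).trace :=
        Finset.sum_range_sub' (fun i => (A⁻¹ * (B i - A)).trace) k
    _ ≤ (A⁻¹ * (B 0 - A)).trace :=
        sub_le_self _ (hA.inv.posSemidef.trace_mul_nonneg (hAB k le_rfl))
    _ = L * A⁻¹.trace - n := by
        rw [hB0, Matrix.mul_sub, Matrix.nonsing_inv_mul A hdet, Matrix.mul_smul, Matrix.mul_one,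
          Matrix.trace_sub, Matrix.trace_smul, Matrix.trace_one, Fintype.card_fin, smul_eq_mul]
    _ ≤ L * A⁻¹.trace := sub_le_self _ n.cast_nonneg
    _ ≤ L * (n / μ) :=
        mul_le_mul_of_nonneg_left (trace_inv_le hμ hA hAlow) (hμ.le.trans hμL)
    _ = n * L / μ := by ring
end
end

section
/- Let A and B be n×n real symmetric positive definite matrices with A ⪯ B, let s ∈ ℝⁿ \ {0}, g = As, and let B⁺ be the BFGS update of B with pair (s, g). Define σ(A, G) := Tr(A⁻¹(G − A)). Then σ(A, B) − σ(A, B⁺) = ⟨BA⁻¹Bs, s⟩/⟨Bs, s⟩ − 1 ≥ ⟨(B − A)A⁻¹(B − A)s, s⟩/⟨Bs, s⟩. -/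
open scoped Matrix

noncomputable section

/-- `σ(A, G) := Tr(A⁻¹ (G − A))`. -/
def sigmaPot {n : ℕ} (A G : Matrix (Fin n) (Fin n) ℝ) : ℝ :=
  Matrix.trace (A⁻¹ * (G - A))

/-- Let `A ⪯ B` be symmetric positive definite, `s ≠ 0`, `g = A s`, and let
`B⁺` be the BFGS update of `B` with pair `(s, g)`.  Then
`σ(A,B) − σ(A,B⁺) = ⟨B A⁻¹ B s, s⟩/⟨B s, s⟩ − 1 ≥ ⟨(B−A) A⁻¹ (B−A) s, s⟩/⟨B s, s⟩`. -/
theorem bfgs_sigma_decrease {n : ℕ} (A B : Matrix (Fin n) (Fin n) ℝ)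
    (hA : A.PosDef) (hB : B.PosDef) (hAB : (B - A).PosSemidef)
    (s : Fin n → ℝ) (hs : s ≠ 0) :
    sigmaPot A B - sigmaPot A (bfgsUpdate B s (A.mulVec s)) =
        ((B * A⁻¹ * B).mulVec s ⬝ᵥ s) / (B.mulVec s ⬝ᵥ s) - 1 ∧
      ((B - A) * A⁻¹ * (B - A)).mulVec s ⬝ᵥ s / (B.mulVec s ⬝ᵥ s) ≤
        ((B * A⁻¹ * B).mulVec s ⬝ᵥ s) / (B.mulVec s ⬝ᵥ s) - 1 := by
  have hdet : IsUnit A.det := (Matrix.isUnit_iff_isUnit_det A).1 hA.isUnit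
  have hAi : A⁻¹ * A = 1 := Matrix.nonsing_inv_mul A hdet
  have hAi' : A * A⁻¹ = 1 := Matrix.mul_nonsing_inv A hdet
  have ha : 0 < A.mulVec s ⬝ᵥ s := by
    simpa [dotProduct_comm] using hA.dotProduct_mulVec_pos hs
  have hb : 0 < B.mulVec s ⬝ᵥ s := by
    simpa [dotProduct_comm] using hB.dotProduct_mulVec_pos hs
  have hab : A.mulVec s ⬝ᵥ s ≤ B.mulVec s ⬝ᵥ s := by
    have h := hAB.dotProduct_mulVec_nonneg s
    rw [star_trivial, dotProduct_comm, Matrix.sub_mulVec, sub_dotProduct] at h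
    linarith
  constructor
  · have hvB : (A⁻¹ * B).mulVec s ⬝ᵥ Matrix.vecMul s B = (B * A⁻¹ * B).mulVec s ⬝ᵥ s := by
      rw [dotProduct_comm, ← Matrix.dotProduct_mulVec, Matrix.mulVec_mulVec, ← mul_assoc,
        dotProduct_comm]
    unfold sigmaPot bfgsUpdate
    rw [← Matrix.trace_sub, ← mul_sub, sub_sub_sub_cancel_right, sub_add_eq_sub_sub, sub_sub_cancel,
      mul_sub, Matrix.mul_smul, Matrix.mul_smul, Matrix.mul_vecMulVec, Matrix.mul_vecMulVec,
      Matrix.mulVec_mulVec, Matrix.mulVec_mulVec, hAi, Matrix.one_mulVec, Matrix.trace_sub,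
      Matrix.trace_smul, Matrix.trace_smul, Matrix.trace_vecMulVec, Matrix.trace_vecMulVec, hvB,
      dotProduct_comm s (B.mulVec s), dotProduct_comm s (A.mulVec s), smul_eq_mul, smul_eq_mul,
      inv_mul_cancel₀ ha.ne', div_eq_inv_mul]
  · have hexp : (B - A) * A⁻¹ * (B - A) = B * A⁻¹ * B - B - B + A := by
      rw [sub_mul, hAi', sub_mul, mul_sub, mul_assoc B A⁻¹ A, hAi, mul_one, one_mul]
      abel
    rw [hexp, Matrix.add_mulVec, Matrix.sub_mulVec, Matrix.sub_mulVec, add_dotProduct,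
      sub_dotProduct, sub_dotProduct, div_sub_one hb.ne']
    gcongr
    linarith
end
end

section
/- Let f : ℝ^m × ℝⁿ → ℝ satisfy Assumption 2 (in particular, f(x,·) is μ-strongly convex with L_fyy-Lipschitz Hessian ∇²_{yy}f(x,·)), and let F satisfy ‖∇_yF(x,y)‖ ≤ C_Fy with ∇_yF(x,·) L_Fy-Lipschitz. Fix x and let y* minimize f(x,·), let y_T ∈ ℝⁿ, and let u_1,…,u_Q (Q > 1) be vectors satisfying Σ_{i=1}^{Q} ‖[∇²_{yy}f(x,y_T)]⁻¹∇_yF(x,y_T) − u_i‖² ≤ nLC_Fy²/(ξ̃μ³) for some ξ̃ > 0. Let ū be an element of {u_1,…,u_Q} minimizing ‖[∇²_{yy}f(x,y_T)]⁻¹∇_yF(x,y_T) − u_i‖, and set u* := [∇²_{yy}f(x,y*)]⁻¹∇_yF(x,y*). Then ‖ū − u*‖² ≤ 2nLC_Fy²/(ξ̃μ³Q) + 4(L_Fy²/μ² + C_Fy²L_fyy²/μ⁴)‖y* − y_T‖². -/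
noncomputable section

/-- A matrix dominating `μ • 1` expands norms by at least the factor `μ`. -/
theorem mul_norm_le_norm_mvec {n : ℕ} {A : Matrix (Fin n) (Fin n) ℝ} {μ : ℝ}
    (hA : (A - μ • (1 : Matrix (Fin n) (Fin n) ℝ)).PosSemidef) (v : EuclideanSpace ℝ (Fin n)) :
    μ * ‖v‖ ≤ ‖mvec A v‖ := by
  have h := hA.dotProduct_mulVec_nonneg v.ofLp
  have hinner : inner ℝ v (mvec A v) = v.ofLp ⬝ᵥ A.mulVec v.ofLp := by
    simp [mvec, PiLp.inner_apply, dotProduct, mul_comm, Matrix.toLpLin_apply]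
  have hself : v.ofLp ⬝ᵥ v.ofLp = ‖v‖ ^ 2 := by
    rw [EuclideanSpace.real_norm_sq_eq]
    simp [dotProduct, sq]
  have hμ : μ * ‖v‖ ^ 2 ≤ inner ℝ v (mvec A v) := by
    rw [hinner, ← hself]
    simpa [Matrix.sub_mulVec, Matrix.smul_mulVec, dotProduct_sub] using h
  have hcs := real_inner_le_norm v (mvec A v)
  rcases (norm_nonneg v).eq_or_lt with hv | hv
  · simp [← hv]
  · exact le_of_mul_le_mul_left (by linarith [sq ‖v‖]) hv

/-- A matrix dominating `μ • 1` with `μ > 0` is inverted by its matrix inverse. -/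
theorem mvec_mvec_inv {n : ℕ} {A : Matrix (Fin n) (Fin n) ℝ} {μ : ℝ} (hμ : 0 < μ)
    (hA : (A - μ • (1 : Matrix (Fin n) (Fin n) ℝ)).PosSemidef) (v : EuclideanSpace ℝ (Fin n)) :
    mvec A (mvec A⁻¹ v) = v := by
  have hpd : A.PosDef := by
    simpa using (Matrix.PosDef.one.smul hμ).add_posSemidef hA
  have hdet : IsUnit A.det := hpd.det_pos.ne'.isUnit
  simp [mvec, Matrix.toLpLin_apply, Matrix.mulVec_mulVec, Matrix.mul_nonsing_inv A hdet]

theorem norm_mvec_le {p q : ℕ} (A : Matrix (Fin p) (Fin q) ℝ) (v : EuclideanSpace ℝ (Fin q)) :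
    ‖mvec A v‖ ≤ opn A * ‖v‖ :=
  (Matrix.toEuclideanLin A).toContinuousLinearMap.le_opNorm v

/-- Perturbation bound for the solutions of two uniformly positive definite linear systems. -/
theorem norm_mvec_inv_sub_le {n : ℕ} {A B : Matrix (Fin n) (Fin n) ℝ} {μ : ℝ} (hμ : 0 < μ)
    (hA : (A - μ • (1 : Matrix (Fin n) (Fin n) ℝ)).PosSemidef)
    (hB : (B - μ • (1 : Matrix (Fin n) (Fin n) ℝ)).PosSemidef)
    (a b : EuclideanSpace ℝ (Fin n)) :
    ‖mvec A⁻¹ a - mvec B⁻¹ b‖ ≤ ‖a - b‖ / μ + opn (A - B) * ‖b‖ / μ ^ 2 := by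
  have hsolve : mvec A (mvec A⁻¹ a - mvec B⁻¹ b) = a - b - mvec (A - B) (mvec B⁻¹ b) := by
    have hAa := mvec_mvec_inv hμ hA a
    have hBb := mvec_mvec_inv hμ hB b
    calc mvec A (mvec A⁻¹ a - mvec B⁻¹ b)
        = mvec A (mvec A⁻¹ a) - mvec B (mvec B⁻¹ b) - mvec (A - B) (mvec B⁻¹ b) := by
          simp [mvec, map_sub]
      _ = a - b - mvec (A - B) (mvec B⁻¹ b) := by rw [hAa, hBb]
  have hb : ‖mvec B⁻¹ b‖ ≤ ‖b‖ / μ := by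
    rw [le_div_iff₀' hμ]
    simpa [mvec_mvec_inv hμ hB b] using mul_norm_le_norm_mvec hB (mvec B⁻¹ b)
  have hop : 0 ≤ opn (A - B) := norm_nonneg _
  calc ‖mvec A⁻¹ a - mvec B⁻¹ b‖
      ≤ ‖a - b - mvec (A - B) (mvec B⁻¹ b)‖ / μ := by
        rw [le_div_iff₀' hμ, ← hsolve]
        exact mul_norm_le_norm_mvec hA _
    _ ≤ (‖a - b‖ + opn (A - B) * (‖b‖ / μ)) / μ := by
        gcongr
        refine (norm_sub_le _ _).trans (add_le_add_right ?_ _)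
        exact (norm_mvec_le _ _).trans (by gcongr)
    _ = ‖a - b‖ / μ + opn (A - B) * ‖b‖ / μ ^ 2 := by field_simp

/-- Error of the selected `u`-iterate in the general (non-quadratic) case:
`‖ū − u*‖² ≤ 2 n L C_Fy²/(ξ̃ μ³ Q) + 4 (L_Fy²/μ² + C_Fy² L_fyy²/μ⁴) ‖y* − y_T‖²`. -/
theorem selected_u_error_general {m n : ℕ}
    (f : EuclideanSpace ℝ (Fin m) → EuclideanSpace ℝ (Fin n) → ℝ)
    (F : EuclideanSpace ℝ (Fin m) → EuclideanSpace ℝ (Fin n) → ℝ)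
    (hf : ContDiff ℝ 2 (fun p : EuclideanSpace ℝ (Fin m) × EuclideanSpace ℝ (Fin n) =>
      f p.1 p.2))
    (fy Fy : EuclideanSpace ℝ (Fin m) → EuclideanSpace ℝ (Fin n) → EuclideanSpace ℝ (Fin n))
    (fyy : EuclideanSpace ℝ (Fin m) → EuclideanSpace ℝ (Fin n) → Matrix (Fin n) (Fin n) ℝ)
    (hfy : ∀ x y, HasGradientAt (fun y' => f x y') (fy x y) y)
    (hfyy : ∀ x y, HasFDerivAt (fun y' => fy x y')
      (Matrix.toEuclideanLin (fyy x y)).toContinuousLinearMap y)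
    (hFy : ∀ x y, HasGradientAt (fun y' => F x y') (Fy x y) y)
    (μ L Lfyy LFy CFy : ℝ) (hμ : 0 < μ)
    -- Assumption 2: strong convexity, Lipschitz gradient and Lipschitz Hessian in `y`
    (hsc : ∀ x y, (fyy x y - μ • (1 : Matrix (Fin n) (Fin n) ℝ)).PosSemidef)
    (hfyLip : ∀ x y₁ y₂, ‖fy x y₁ - fy x y₂‖ ≤ L * ‖y₁ - y₂‖)
    (hfyyLip : ∀ x y₁ y₂, opn (fyy x y₁ - fyy x y₂) ≤ Lfyy * ‖y₁ - y₂‖)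
    -- Assumption 1 (the parts about `∇_y F`)
    (hFybd : ∀ x y, ‖Fy x y‖ ≤ CFy)
    (hFyLip : ∀ x y₁ y₂, ‖Fy x y₁ - Fy x y₂‖ ≤ LFy * ‖y₁ - y₂‖)
    -- fixed `x`, the minimizer `y*`, the point `y_T` and the candidate vectors `uᵢ`
    (x : EuclideanSpace ℝ (Fin m)) (ystar yT : EuclideanSpace ℝ (Fin n))
    (hystar : ∀ y, f x ystar ≤ f x y)
    (Q : ℕ) (hQ : 1 < Q) (u : ℕ → EuclideanSpace ℝ (Fin n)) (ξt : ℝ) (hξt : 0 < ξt)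
    (hsum : ∑ i ∈ Finset.Icc 1 Q, ‖mvec (fyy x yT)⁻¹ (Fy x yT) - u i‖ ^ 2 ≤
      n * L * CFy ^ 2 / (ξt * μ ^ 3))
    (ubar : EuclideanSpace ℝ (Fin n)) (i₀ : ℕ) (hi₀ : i₀ ∈ Finset.Icc 1 Q)
    (hubar : ubar = u i₀)
    (hmin : ∀ i ∈ Finset.Icc 1 Q,
      ‖mvec (fyy x yT)⁻¹ (Fy x yT) - ubar‖ ≤ ‖mvec (fyy x yT)⁻¹ (Fy x yT) - u i‖) :
    ‖ubar - mvec (fyy x ystar)⁻¹ (Fy x ystar)‖ ^ 2 ≤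
      2 * n * L * CFy ^ 2 / (ξt * μ ^ 3 * Q) +
        4 * (LFy ^ 2 / μ ^ 2 + CFy ^ 2 * Lfyy ^ 2 / μ ^ 4) * ‖ystar - yT‖ ^ 2 := by
  set w := mvec (fyy x yT)⁻¹ (Fy x yT)
  set d := ‖ystar - yT‖ with hd
  have hQpos : (0 : ℝ) < Q := by exact_mod_cast zero_lt_one.trans hQ
  have hsel : ‖w - ubar‖ ^ 2 ≤ n * L * CFy ^ 2 / (ξt * μ ^ 3) / Q := by
    rw [le_div_iff₀' hQpos]
    refine le_trans ?_ hsum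
    have h := Finset.card_nsmul_le_sum (Finset.Icc 1 Q) (fun i => ‖w - u i‖ ^ 2) (‖w - ubar‖ ^ 2)
      fun i hi => pow_le_pow_left₀ (norm_nonneg _) (hmin i hi) 2
    simpa using h
  have hpert : ‖w - mvec (fyy x ystar)⁻¹ (Fy x ystar)‖ ≤
      LFy / μ * d + CFy * Lfyy / μ ^ 2 * d := by
    have hg : ‖Fy x yT - Fy x ystar‖ ≤ LFy * d := by
      simpa [hd, norm_sub_rev ystar yT] using hFyLip x yT ystar
    have hH : opn (fyy x yT - fyy x ystar) ≤ Lfyy * d := by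
      simpa [hd, norm_sub_rev ystar yT] using hfyyLip x yT ystar
    have hH0 : 0 ≤ Lfyy * d := (norm_nonneg _).trans hH
    calc ‖w - mvec (fyy x ystar)⁻¹ (Fy x ystar)‖
        ≤ ‖Fy x yT - Fy x ystar‖ / μ +
            opn (fyy x yT - fyy x ystar) * ‖Fy x ystar‖ / μ ^ 2 :=
          norm_mvec_inv_sub_le hμ (hsc x yT) (hsc x ystar) _ _
      _ ≤ LFy * d / μ + Lfyy * d * CFy / μ ^ 2 := by
          gcongr
          exact hFybd x ystar
      _ = LFy / μ * d + CFy * Lfyy / μ ^ 2 * d := by ring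
  have hpert_sq : ‖w - mvec (fyy x ystar)⁻¹ (Fy x ystar)‖ ^ 2 ≤
      2 * ((LFy / μ * d) ^ 2 + (CFy * Lfyy / μ ^ 2 * d) ^ 2) :=
    (pow_le_pow_left₀ (norm_nonneg _) hpert 2).trans add_sq_le
  have htri : ‖ubar - mvec (fyy x ystar)⁻¹ (Fy x ystar)‖ ≤
      ‖w - ubar‖ + ‖w - mvec (fyy x ystar)⁻¹ (Fy x ystar)‖ := by
    rw [norm_sub_rev w ubar]
    exact norm_sub_le_norm_sub_add_norm_sub _ _ _
  calc ‖ubar - mvec (fyy x ystar)⁻¹ (Fy x ystar)‖ ^ 2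
      ≤ 2 * (‖w - ubar‖ ^ 2 + ‖w - mvec (fyy x ystar)⁻¹ (Fy x ystar)‖ ^ 2) :=
        (pow_le_pow_left₀ (norm_nonneg _) htri 2).trans add_sq_le
    _ ≤ 2 * (n * L * CFy ^ 2 / (ξt * μ ^ 3) / Q +
          2 * ((LFy / μ * d) ^ 2 + (CFy * Lfyy / μ ^ 2 * d) ^ 2)) := by gcongr
    _ = 2 * n * L * CFy ^ 2 / (ξt * μ ^ 3 * Q) +
        4 * (LFy ^ 2 / μ ^ 2 + CFy ^ 2 * Lfyy ^ 2 / μ ^ 4) * d ^ 2 := by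
        field_simp
        ring
end
end

section
/- Let Φ : ℝ^m → ℝ be differentiable with L_Φ-Lipschitz gradient and inf_x Φ(x) > −∞. Let α > 0, τ ∈ (0,1), δ₀ ≥ 0, ω ≥ 0, D ≥ 0, and Q_k ≥ 1 for all k. Suppose a sequence x_k is generated by x_{k+1} = x_k − α g_k, where the errors e_k := ‖g_k − ∇Φ(x_k)‖² satisfy, for every k ≥ 0, e_k ≤ δ₀ τ^k + ω α² Σ_{j=0}^{k−1} τ^j ‖∇Φ(x_{k−1−j})‖² + ω α² D Σ_{j=0}^{k−1} τ^j / Q_{k−1−j} + D/Q_k, and suppose αL_Φ + ωα²(1/2 + αL_Φ)/(1−τ) ≤ 1/4. Then for every K ≥ 1: (1/K) Σ_{k=0}^{K−1} ‖∇Φ(x_k)‖² ≤ 4(Φ(x₀) − inf_x Φ(x))/(αK) + 3δ₀/(K(1−τ)) + (3D/K) Σ_{k=0}^{K−1} 1/Q_k. -/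
/-- Descent lemma: the quadratic upper bound for a function with Lipschitz gradient. -/
theorem le_quadratic_of_gradient_lipschitz {E : Type*} [NormedAddCommGroup E]
    [InnerProductSpace ℝ E] [CompleteSpace E] {f : E → ℝ} {L : ℝ}
    (hf : ∀ x, DifferentiableAt ℝ f x)
    (hL : ∀ x y, ‖gradient f x - gradient f y‖ ≤ L * ‖x - y‖) (x v : E) :
    f (x + v) ≤ f x + inner ℝ (gradient f x) v + L / 2 * ‖v‖ ^ 2 := by
  let φ : ℝ → ℝ := fun t ↦ f (x + t • v) - (t * inner ℝ (gradient f x) v + L / 2 * ‖v‖ ^ 2 * t ^ 2)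
  have hφ (t : ℝ) : HasDerivAt φ (inner ℝ (gradient f (x + t • v)) v -
      (inner ℝ (gradient f x) v + L * ‖v‖ ^ 2 * t)) t := by
    have hline : HasDerivAt (fun t : ℝ ↦ x + t • v) v t := by
      simpa using ((hasDerivAt_id t).smul_const v).const_add x
    have hcomp := (hf (x + t • v)).hasGradientAt.hasFDerivAt.comp_hasDerivAt t hline
    have hquad := ((hasDerivAt_id t).mul_const (inner ℝ (gradient f x) v)).add
      ((hasDerivAt_pow 2 t).const_mul (L / 2 * ‖v‖ ^ 2))
    refine (hcomp.sub hquad).congr_deriv ?_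
    simp
    ring
  have hanti : AntitoneOn φ (Set.Icc 0 1) := by
    refine antitoneOn_of_deriv_nonpos (convex_Icc 0 1)
      (fun t _ ↦ (hφ t).continuousAt.continuousWithinAt)
      (fun t _ ↦ (hφ t).differentiableAt.differentiableWithinAt) fun t ht ↦ ?_
    rw [interior_Icc] at ht
    rw [(hφ t).deriv]
    have hinner : inner ℝ (gradient f (x + t • v) - gradient f x) v ≤ L * ‖v‖ ^ 2 * t :=
      calc inner ℝ (gradient f (x + t • v) - gradient f x) v
          ≤ ‖gradient f (x + t • v) - gradient f x‖ * ‖v‖ := real_inner_le_norm _ _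
        _ ≤ L * ‖x + t • v - x‖ * ‖v‖ := by gcongr; exact hL _ _
        _ = L * ‖v‖ ^ 2 * t := by
          rw [add_sub_cancel_left, norm_smul, Real.norm_of_nonneg ht.1.le]
          ring
    rw [inner_sub_left] at hinner
    linarith
  have h01 := hanti (Set.left_mem_Icc.2 zero_le_one) (Set.right_mem_Icc.2 zero_le_one) zero_le_one
  simp only [φ, one_smul, zero_smul, add_zero] at h01
  linarith

/-- One step of inexact gradient descent. -/
theorem inexact_gradient_step_le {E : Type*} [NormedAddCommGroup E]
    [InnerProductSpace ℝ E] [CompleteSpace E] {f : E → ℝ} {L α : ℝ}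
    (hf : ∀ x, DifferentiableAt ℝ f x)
    (hL : ∀ x y, ‖gradient f x - gradient f y‖ ≤ L * ‖x - y‖)
    (hL0 : 0 ≤ L) (hα : 0 ≤ α) (x g : E) :
    f (x - α • g) ≤ f x - (α / 2 - α ^ 2 * L) * ‖gradient f x‖ ^ 2 +
      (α / 2 + α ^ 2 * L) * ‖g - gradient f x‖ ^ 2 := by
  have h := le_quadratic_of_gradient_lipschitz hf hL x (-(α • g))
  rw [← sub_eq_add_neg, inner_neg_right, real_inner_smul_right, norm_neg, norm_smul, mul_pow,
    Real.norm_eq_abs, sq_abs] at h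
  generalize gradient f x = p at h ⊢
  have hexp := norm_sub_sq_real g p
  rw [real_inner_comm] at hexp
  have hpar : ‖g‖ ^ 2 ≤ 2 * ‖p‖ ^ 2 + 2 * ‖g - p‖ ^ 2 := by
    have htri : ‖g‖ ≤ ‖p‖ + ‖g - p‖ := by simpa using norm_add_le p (g - p)
    nlinarith [norm_nonneg g, sq_nonneg (‖p‖ - ‖g - p‖)]
  have h1 := mul_le_mul_of_nonneg_left hpar (by positivity : 0 ≤ L / 2 * α ^ 2)
  have h2 : 0 ≤ α * ‖g‖ ^ 2 := by positivity
  have h3 : α * ‖g - p‖ ^ 2 = α * (‖g‖ ^ 2 - 2 * inner ℝ p g + ‖p‖ ^ 2) := by rw [hexp]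
  linarith

/-- Summing a geometric convolution. -/
theorem sum_geometric_convolution (τ : ℝ) (a : ℕ → ℝ) (K : ℕ) :
    (1 - τ) * ∑ k ∈ Finset.range K, ∑ j ∈ Finset.range k, τ ^ j * a (k - 1 - j) +
      ∑ j ∈ Finset.range K, τ ^ j * a (K - 1 - j) = ∑ k ∈ Finset.range K, a k := by
  induction K with
  | zero => simp
  | succ K ih =>
    have hrec : ∑ j ∈ Finset.range (K + 1), τ ^ j * a (K + 1 - 1 - j) =
        τ * ∑ j ∈ Finset.range K, τ ^ j * a (K - 1 - j) + a K := by
      rw [Finset.sum_range_succ', Finset.mul_sum]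
      congr 1
      · refine Finset.sum_congr rfl fun j _ ↦ ?_
        rw [show K + 1 - 1 - (j + 1) = K - 1 - j by omega]
        ring
      · simp
    rw [hrec, Finset.sum_range_succ, Finset.sum_range_succ, ← ih]
    ring

theorem sum_geometric_convolution_le {τ : ℝ} (hτ0 : 0 ≤ τ) (hτ1 : τ < 1) {a : ℕ → ℝ}
    (ha : ∀ k, 0 ≤ a k) (K : ℕ) :
    ∑ k ∈ Finset.range K, ∑ j ∈ Finset.range k, τ ^ j * a (k - 1 - j) ≤
      (∑ k ∈ Finset.range K, a k) / (1 - τ) := by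
  rw [le_div_iff₀ (sub_pos.2 hτ1), ← sum_geometric_convolution τ a K, mul_comm]
  exact le_add_of_nonneg_right (Finset.sum_nonneg fun j _ ↦ mul_nonneg (pow_nonneg hτ0 j) (ha _))

/-- Descent-aggregation step of the qNBO convergence proofs: if `∇Φ` is
`L_Φ`-Lipschitz, `Φ` is bounded below, `x_{k+1} = x_k − α g_k`, and the errors
`e_k = ‖g_k − ∇Φ(x_k)‖²` satisfy the stated recursive bound, and
`α L_Φ + ω α² (1/2 + α L_Φ)/(1−τ) ≤ 1/4`, then for every `K ≥ 1`,
`(1/K) Σ_{k<K} ‖∇Φ(x_k)‖² ≤ 4(Φ(x₀) − inf Φ)/(αK) + 3δ₀/(K(1−τ)) + (3D/K) Σ_{k<K} 1/Q_k`. -/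
theorem qNBO_descent_aggregation {m : ℕ}
    (Φ : EuclideanSpace ℝ (Fin m) → ℝ)
    (hdiff : ∀ x, DifferentiableAt ℝ Φ x)
    (LΦ : ℝ)
    (hLip : ∀ x₁ x₂, ‖gradient Φ x₁ - gradient Φ x₂‖ ≤ LΦ * ‖x₁ - x₂‖)
    (hbdd : BddBelow (Set.range Φ))
    (α τ δ₀ ω D : ℝ) (hα : 0 < α) (hτ0 : 0 < τ) (hτ1 : τ < 1)
    (hδ₀ : 0 ≤ δ₀) (hω : 0 ≤ ω) (hD : 0 ≤ D)
    (Q : ℕ → ℝ) (hQ : ∀ k, 1 ≤ Q k)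
    (x g : ℕ → EuclideanSpace ℝ (Fin m))
    (hstep : ∀ k, x (k + 1) = x k - α • g k)
    (herr : ∀ k, ‖g k - gradient Φ (x k)‖ ^ 2 ≤
      δ₀ * τ ^ k + ω * α ^ 2 * ∑ j ∈ Finset.range k, τ ^ j * ‖gradient Φ (x (k - 1 - j))‖ ^ 2 +
        ω * α ^ 2 * D * ∑ j ∈ Finset.range k, τ ^ j / Q (k - 1 - j) + D / Q k)
    (hstepsize : α * LΦ + ω * α ^ 2 * (1 / 2 + α * LΦ) / (1 - τ) ≤ 1 / 4) :
    ∀ K : ℕ, 1 ≤ K →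
      (1 / K : ℝ) * ∑ k ∈ Finset.range K, ‖gradient Φ (x k)‖ ^ 2 ≤
        4 * (Φ (x 0) - ⨅ x', Φ x') / (α * K) + 3 * δ₀ / (K * (1 - τ)) +
          (3 * D / K) * ∑ k ∈ Finset.range K, 1 / Q k := by
  intro K hK
  have hτ : 0 < 1 - τ := sub_pos.2 hτ1
  have hKpos : (0 : ℝ) < K := by exact_mod_cast hK
  have hQinv (k : ℕ) : 0 ≤ 1 / Q k := one_div_nonneg.2 (zero_le_one.trans (hQ k))
  have hinf (y) : ⨅ x', Φ x' ≤ Φ y := ciInf_le hbdd y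
  set S := ∑ k ∈ Finset.range K, 1 / Q k with hS
  have hS0 : 0 ≤ S := Finset.sum_nonneg fun k _ ↦ hQinv k
  set G := ∑ k ∈ Finset.range K, ‖gradient Φ (x k)‖ ^ 2
  have hG0 : 0 ≤ G := Finset.sum_nonneg fun k _ ↦ sq_nonneg _
  suffices hmain : G ≤ 4 * (Φ (x 0) - ⨅ x', Φ x') / α + 3 * δ₀ / (1 - τ) + 3 * D * S by
    calc (1 / K : ℝ) * G
        ≤ 1 / K * (4 * (Φ (x 0) - ⨅ x', Φ x') / α + 3 * δ₀ / (1 - τ) + 3 * D * S) := by gcongr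
      _ = _ := by field_simp
  rcases subsingleton_or_nontrivial (EuclideanSpace ℝ (Fin m)) with hsub | hnon
  · have hG_zero : G = 0 :=
      Finset.sum_eq_zero fun k _ ↦ by simp [Subsingleton.elim (gradient Φ (x k)) 0]
    have := sub_nonneg.2 (hinf (x 0))
    rw [hG_zero]
    positivity
  have hL0 : 0 ≤ LΦ := by
    obtain ⟨y, hy⟩ := exists_ne (0 : EuclideanSpace ℝ (Fin m))
    have h := (norm_nonneg _).trans (hLip y 0)
    rw [sub_zero] at h
    exact nonneg_of_mul_nonneg_left h (norm_pos_iff.2 hy)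
  set e : ℕ → ℝ := fun k ↦ ‖g k - gradient Φ (x k)‖ ^ 2
  have hdescent (n : ℕ) : Φ (x n) ≤ Φ (x 0) -
      (α / 2 - α ^ 2 * LΦ) * ∑ k ∈ Finset.range n, ‖gradient Φ (x k)‖ ^ 2 +
      (α / 2 + α ^ 2 * LΦ) * ∑ k ∈ Finset.range n, e k := by
    induction n with
    | zero => simp
    | succ n ih =>
      have h := inexact_gradient_step_le hdiff hLip hL0 hα.le (x n) (g n)
      rw [← hstep] at h
      rw [Finset.sum_range_succ, Finset.sum_range_succ]
      linarith
  set c := ω * α ^ 2 / (1 - τ) with hc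
  have herr_sum : ∑ k ∈ Finset.range K, e k ≤ δ₀ / (1 - τ) + c * G + c * D * S + D * S := by
    have hgeom : ∑ k ∈ Finset.range K, τ ^ k ≤ 1 / (1 - τ) := by
      rw [le_div_iff₀ hτ, geom_sum_mul_neg]
      linarith [pow_nonneg hτ0.le K]
    have hconvG := sum_geometric_convolution_le hτ0.le hτ1
      (a := fun k ↦ ‖gradient Φ (x k)‖ ^ 2) (fun k ↦ sq_nonneg _) K
    have hconvQ := sum_geometric_convolution_le hτ0.le hτ1 (a := fun k ↦ 1 / Q k) hQinv K
    simp only [mul_one_div] at hconvQ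
    calc ∑ k ∈ Finset.range K, e k ≤ _ := Finset.sum_le_sum fun k _ ↦ herr k
      _ = δ₀ * ∑ k ∈ Finset.range K, τ ^ k +
          ω * α ^ 2 * ∑ k ∈ Finset.range K, ∑ j ∈ Finset.range k,
            τ ^ j * ‖gradient Φ (x (k - 1 - j))‖ ^ 2 +
          ω * α ^ 2 * D * ∑ k ∈ Finset.range K, ∑ j ∈ Finset.range k, τ ^ j / Q (k - 1 - j) +
          D * S := by
        simp only [Finset.sum_add_distrib, ← Finset.mul_sum, hS, div_eq_mul_one_div D]
      _ ≤ δ₀ * (1 / (1 - τ)) + ω * α ^ 2 * (G / (1 - τ)) +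
          ω * α ^ 2 * D * (S / (1 - τ)) + D * S := by gcongr
      _ = _ := by rw [hc]; ring
  have hstep' : α * LΦ + c * (1 / 2 + α * LΦ) ≤ 1 / 4 := by
    convert hstepsize using 2
    rw [hc]; ring
  have hc0 : 0 ≤ c := by positivity
  have hαL : 0 ≤ α * LΦ := by positivity
  have hαL_le : α * LΦ ≤ 1 / 4 := by
    have : 0 ≤ c * (1 / 2 + α * LΦ) := by positivity
    linarith
  have hsum : (1 / 2 - α * LΦ) * G ≤ (Φ (x 0) - ⨅ x', Φ x') / α +
      (1 / 2 + α * LΦ) * ∑ k ∈ Finset.range K, e k := by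
    rw [← sub_le_iff_le_add, le_div_iff₀ hα]
    linarith [hdescent K, hinf (x K)]
  have h1 := mul_le_mul_of_nonneg_left herr_sum (by positivity : 0 ≤ 1 / 2 + α * LΦ)
  have h2 := mul_le_mul_of_nonneg_right hstep' hG0
  have h3 := mul_le_mul_of_nonneg_right hstep' (mul_nonneg hD hS0)
  have h4 := mul_le_mul_of_nonneg_right hαL_le (by positivity : 0 ≤ δ₀ / (1 - τ))
  rw [mul_div_assoc, mul_div_assoc]
  linarith
end
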